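/- arXiv:2302.00097 — 2 statements merged into one kernel-verified Lean document; each statement's English description precedes it below -/
import Mathlib

section
/- There is a universal constant c > 0 with the following property. Let λ > 1 and α ∈ ℝ, and set f(s) = −s² + α·s. Let x, y > 0 satisfy √x < λ/2 and √y < λ/2, and let t ∈ [0, √x + 1]. If B is a Brownian bridge of variance 2 from (0, x) to (λ, y + f(λ)), then P( B(s) > f(s) for all s ∈ [t, λ] ) ≤ exp( −J(x, y, λ) + c·λ·log(1 + λ) ). -/
open MeasureTheory ProbabilityTheory

/-- `IsBrownianBridge P B a b u v` says that, under the probability measure `P`, the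
process `B` is a Brownian bridge of variance `2` from `(a, u)` to `(b, v)`: it has almost
surely continuous sample paths on `[a, b]`, satisfies `B a = u` and `B b = v` almost surely,
its finite-dimensional marginals on `[a, b]` are (possibly degenerate) Gaussian, its mean is
`E[B s] = u + ((s−a)/(b−a))(v−u)`, and its covariance is
`Cov(B r, B s) = 2 (r−a)(b−s)/(b−a)` for `a ≤ r ≤ s ≤ b`. -/
structure IsBrownianBridge {Ω : Type*} [MeasurableSpace Ω] (P : Measure Ω)
    (B : ℝ → Ω → ℝ) (a b u v : ℝ) : Prop where
  meas : ∀ s, Measurable (B s)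
  cont : ∀ᵐ ω ∂P, ContinuousOn (fun s => B s ω) (Set.Icc a b)
  start : ∀ᵐ ω ∂P, B a ω = u
  finish : ∀ᵐ ω ∂P, B b ω = v
  gaussian : ∀ (n : ℕ) (s c : Fin n → ℝ), (∀ i, s i ∈ Set.Icc a b) →
      ∃ (μ : ℝ) (V : NNReal),
        P.map (fun ω => ∑ i, c i * B (s i) ω) = ProbabilityTheory.gaussianReal μ V
  mean : ∀ s ∈ Set.Icc a b,
      ∫ ω, B s ω ∂P = u + ((s - a) / (b - a)) * (v - u)
  cov : ∀ r s : ℝ, a ≤ r → r ≤ s → s ≤ b →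
      ∫ ω, (B r ω - (u + ((r - a) / (b - a)) * (v - u))) *
            (B s ω - (u + ((s - a) / (b - a)) * (v - u))) ∂P
        = 2 * (r - a) * (b - s) / (b - a)

/-- The energy functional `E(x, y, λ) = (2/3)x^{3/2} + (λ − √y)²√y + (1/3)(λ − √y)³`. -/
noncomputable def Efun (x y l : ℝ) : ℝ :=
  2 / 3 * x ^ (3 / 2 : ℝ) + (l - Real.sqrt y) ^ 2 * Real.sqrt y +
    1 / 3 * (l - Real.sqrt y) ^ 3

/-- `J(x, y, λ) = E(x, y, λ) − (x − y + λ²)²/(4λ)`. -/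
noncomputable def Jfun (x y l : ℝ) : ℝ :=
  Efun x y l - (x - y + l ^ 2) ^ 2 / (4 * l)

/-- **Chernoff bound** for the upper tail of a real Gaussian random variable. -/
lemma ProbabilityTheory.HasGaussianLaw.measure_ge_le_exp {Ω : Type*} [MeasurableSpace Ω]
    {P : Measure Ω} [IsProbabilityMeasure P] {X : Ω → ℝ} (hX : HasGaussianLaw X P)
    {θ : ℝ} (hθ : 0 ≤ θ) (z : ℝ) :
    P {ω | z ≤ X ω} ≤
      ENNReal.ofReal (Real.exp (-θ * z + P[X] * θ + Var[X; P] * θ ^ 2 / 2)) := by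
  have hmgf := mgf_gaussianReal hX.map_eq_gaussianReal θ
  rw [Real.coe_toNNReal _ (variance_nonneg X P)] at hmgf
  have hint : Integrable (fun ω => Real.exp (θ * X ω)) P := by
    rw [← mgf_pos_iff, hmgf]
    exact Real.exp_pos _
  have h := measure_ge_le_exp_mul_mgf z hθ hint
  rw [hmgf, ← Real.exp_add] at h
  rw [← ofReal_measureReal]
  exact ENNReal.ofReal_le_ofReal (h.trans_eq (by ring_nf))

/-- Summation by parts for the increments of a sequence. -/
lemma sum_range_mul_increment (m b : ℕ → ℝ) (N : ℕ) :
    ∑ i ∈ Finset.range (N + 1), m i * (b (i + 1) - b i) =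
      m N * b (N + 1) - m 0 * b 0 + ∑ i ∈ Finset.range N, (m i - m (i + 1)) * b (i + 1) := by
  induction N with
  | zero => simp; ring
  | succ k ih =>
    rw [Finset.sum_range_succ, ih, Finset.sum_range_succ]
    ring

namespace IsBrownianBridge

variable {Ω : Type*} [MeasurableSpace Ω] {P : Measure Ω} {B : ℝ → Ω → ℝ} {a b u v : ℝ}

lemma hasGaussianLaw_sum (hB : IsBrownianBridge P B a b u v) {n : ℕ} {s : Fin n → ℝ}
    (c : Fin n → ℝ) (hs : ∀ i, s i ∈ Set.Icc a b) :
    HasGaussianLaw (fun ω => ∑ i, c i * B (s i) ω) P where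
  isGaussian_map := by
    obtain ⟨μ, V, h⟩ := hB.gaussian n s c hs
    rw [h]
    infer_instance

lemma hasGaussianLaw_eval (hB : IsBrownianBridge P B a b u v) {s : ℝ} (hs : s ∈ Set.Icc a b) :
    HasGaussianLaw (B s) P := by
  simpa using hB.hasGaussianLaw_sum (n := 1) (s := fun _ => s) (fun _ => 1) (fun _ => hs)

lemma hasGaussianLaw_sum_increment (hB : IsBrownianBridge P B a b u v) {s : ℕ → ℝ} (m : ℕ → ℝ)
    (hs : ∀ i, s i ∈ Set.Icc a b) (N : ℕ) :
    HasGaussianLaw (fun ω => ∑ i ∈ Finset.range N, m i * (B (s (i + 1)) ω - B (s i) ω)) P := by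
  have h := hB.hasGaussianLaw_sum (n := N + N)
    (s := Fin.append (fun i : Fin N => s (i + 1)) (fun i : Fin N => s i))
    (Fin.append (fun i : Fin N => m i) (fun i : Fin N => -m i))
    (fun i => by
      refine Fin.addCases (fun j => ?_) (fun j => ?_) i
      · rw [Fin.append_left]
        exact hs _
      · rw [Fin.append_right]
        exact hs _)
  convert h using 2 with ω
  rw [Fin.sum_univ_add, Finset.sum_range, ← Finset.sum_add_distrib]
  refine Finset.sum_congr rfl fun i _ => ?_
  simp only [Fin.append_left, Fin.append_right]
  ring

lemma covariance_eq (hB : IsBrownianBridge P B a b u v) {r s : ℝ} (hr : a ≤ r) (hrs : r ≤ s)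
    (hs : s ≤ b) : cov[B r, B s; P] = 2 * (r - a) * (b - s) / (b - a) := by
  rw [covariance, hB.mean r ⟨hr, hrs.trans hs⟩, hB.mean s ⟨hr.trans hrs, hs⟩]
  exact hB.cov r s hr hrs hs

variable [IsProbabilityMeasure P]

lemma covariance_increment (hB : IsBrownianBridge P B a b u v) {s : ℕ → ℝ} (hab : a < b)
    (hmono : Monotone s) (hs : ∀ i, s i ∈ Set.Icc a b) (i j : ℕ) :
    cov[fun ω => B (s (i + 1)) ω - B (s i) ω, fun ω => B (s (j + 1)) ω - B (s j) ω; P] =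
      (if i = j then 2 * (s (i + 1) - s i) else 0) -
        2 * (s (i + 1) - s i) * (s (j + 1) - s j) / (b - a) := by
  wlog hij : i ≤ j generalizing i j
  · rw [covariance_comm, this j i (le_of_not_ge hij), if_neg (by lia), if_neg (by lia)]
    ring
  have hL : ∀ k, MemLp (B (s k)) 2 P := fun k => (hB.hasGaussianLaw_eval (hs k)).memLp_two
  have hba : b - a ≠ 0 := (sub_pos.2 hab).ne'
  have hcov : ∀ k k', k ≤ k' →
      cov[B (s k), B (s k'); P] = 2 * (s k - a) * (b - s k') / (b - a) := fun k k' h =>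
    hB.covariance_eq (hs k).1 (hmono h) (hs k').2
  rw [covariance_fun_sub_fun_sub (hL _) (hL _) (hL _) (hL _)]
  rcases hij.eq_or_lt with rfl | hlt
  · rw [covariance_comm (B (s (i + 1))) (B (s i)), hcov _ _ le_rfl, hcov i (i + 1) (by lia),
      hcov _ _ le_rfl, if_pos rfl]
    field_simp
    ring
  · rw [hcov _ _ (by lia), hcov _ _ (by lia), hcov _ _ (by lia), hcov _ _ (by lia),
      if_neg hlt.ne]
    field_simp
    ring

lemma variance_sum_increment (hB : IsBrownianBridge P B a b u v) {s : ℕ → ℝ} (m : ℕ → ℝ)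
    (hab : a < b) (hmono : Monotone s) (hs : ∀ i, s i ∈ Set.Icc a b) (N : ℕ) :
    Var[fun ω => ∑ i ∈ Finset.range N, m i * (B (s (i + 1)) ω - B (s i) ω); P] =
      2 * (∑ i ∈ Finset.range N, m i ^ 2 * (s (i + 1) - s i) -
        (∑ i ∈ Finset.range N, m i * (s (i + 1) - s i)) ^ 2 / (b - a)) := by
  have hL : ∀ k, MemLp (B (s k)) 2 P := fun k => (hB.hasGaussianLaw_eval (hs k)).memLp_two
  have hM : ∀ k, MemLp (fun ω => m k * (B (s (k + 1)) ω - B (s k) ω)) 2 P :=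
    fun k => ((hL (k + 1)).sub (hL k)).const_mul (m k)
  rw [variance_fun_sum' fun i _ => hM i]
  simp_rw [covariance_const_mul_left, covariance_const_mul_right,
    hB.covariance_increment hab hmono hs]
  rw [mul_sub, sq, Finset.sum_mul_sum, Finset.mul_sum, Finset.sum_div, Finset.mul_sum,
    ← Finset.sum_sub_distrib]
  refine Finset.sum_congr rfl fun i hi => ?_
  have hterm : ∀ j, m i * (m j * ((if i = j then 2 * (s (i + 1) - s i) else 0) -
      2 * (s (i + 1) - s i) * (s (j + 1) - s j) / (b - a))) =
      (if i = j then 2 * (m i ^ 2 * (s (i + 1) - s i)) else 0) -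
        2 * (m i * (s (i + 1) - s i) * (m j * (s (j + 1) - s j)) / (b - a)) := by
    intro j
    split_ifs with hij
    · subst hij
      ring
    · ring
  simp_rw [hterm, Finset.sum_sub_distrib, Finset.sum_ite_eq, if_pos hi, ← Finset.mul_sum,
    ← Finset.sum_div, ← Finset.mul_sum]

lemma integral_sum_increment (hB : IsBrownianBridge P B a b u v) {s : ℕ → ℝ} (m : ℕ → ℝ)
    (hs : ∀ i, s i ∈ Set.Icc a b) (N : ℕ) :
    ∫ ω, ∑ i ∈ Finset.range N, m i * (B (s (i + 1)) ω - B (s i) ω) ∂P =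
      (∑ i ∈ Finset.range N, m i * (s (i + 1) - s i)) * ((v - u) / (b - a)) := by
  have hI : ∀ k, Integrable (B (s k)) P :=
    fun k => (hB.hasGaussianLaw_eval (hs k)).memLp_two.integrable one_le_two
  have hI' : ∀ k, Integrable (fun ω => m k * (B (s (k + 1)) ω - B (s k) ω)) P :=
    fun k => ((hI (k + 1)).sub (hI k)).const_mul (m k)
  rw [integral_finsetSum _ fun i _ => hI' i, Finset.sum_mul]
  refine Finset.sum_congr rfl fun i _ => ?_
  rw [integral_const_mul, integral_sub (hI _) (hI _), hB.mean _ (hs _), hB.mean _ (hs _)]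
  ring

/-- A Brownian bridge stays above the interior vertices of a concave polygonal line joining its
endpoints, up to a common linear tilt `α`, with probability at most the exponential of minus
the energy of the line relative to the straight one. -/
lemma measure_above_polygon_le (hB : IsBrownianBridge P B a b u v) {s h m : ℕ → ℝ} (α : ℝ)
    (N : ℕ) (hab : a < b) (hmono : Monotone s) (hsa : s 0 = a) (hsb : ∀ i, N < i → s i = b)
    (hu : u = h 0 + α * a) (hv : v = h (N + 1) + α * b)
    (hslope : ∀ i ≤ N, h (i + 1) - h i = m i * (s (i + 1) - s i))
    (hm : ∀ i < N, m (i + 1) ≤ m i) :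
    P {ω | ∀ i < N, h (i + 1) + α * s (i + 1) ≤ B (s (i + 1)) ω} ≤
      ENNReal.ofReal (Real.exp
        (-((∑ i ∈ Finset.range (N + 1), m i ^ 2 * (s (i + 1) - s i)) / 4 -
          (h (N + 1) - h 0) ^ 2 / (4 * (b - a))))) := by
  have hs : ∀ i, s i ∈ Set.Icc a b := fun i =>
    ⟨hsa ▸ hmono i.zero_le, by
      rw [← hsb (N + 1 + i) (by lia)]; exact hmono (by lia)⟩
  have hba : b - a ≠ 0 := (sub_pos.2 hab).ne'
  set X : Ω → ℝ := fun ω => ∑ i ∈ Finset.range (N + 1), m i * (B (s (i + 1)) ω - B (s i) ω)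
  set z : ℝ := ∑ i ∈ Finset.range (N + 1),
    m i * ((h (i + 1) + α * s (i + 1)) - (h i + α * s i)) with hz
  have hM : ∑ i ∈ Finset.range (N + 1), m i * (s (i + 1) - s i) = h (N + 1) - h 0 := by
    rw [← Finset.sum_range_sub h]
    exact Finset.sum_congr rfl fun i hi => (hslope i (by simpa [Nat.lt_succ_iff] using hi)).symm
  have hz' : z = ∑ i ∈ Finset.range (N + 1), m i ^ 2 * (s (i + 1) - s i) +
      α * (h (N + 1) - h 0) := by
    rw [← hM, Finset.mul_sum, ← Finset.sum_add_distrib]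
    refine Finset.sum_congr rfl fun i hi => ?_
    linear_combination m i * hslope i (by simpa [Nat.lt_succ_iff] using hi)
  have hsub : {ω | ∀ i < N, h (i + 1) + α * s (i + 1) ≤ B (s (i + 1)) ω} ≤ᵐ[P]
      {ω | z ≤ X ω} := by
    filter_upwards [hB.start, hB.finish] with ω h0 h1 hω
    change z ≤ X ω
    rw [hz, sum_range_mul_increment m (fun i => h i + α * s i),
      show X ω = _ from sum_range_mul_increment m (fun i => B (s i) ω) N]
    simp only [hsa, hsb (N + 1) (by lia), h0, h1, ← hu, ← hv]
    gcongr with i hi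
    · exact sub_nonneg.2 (hm i (Finset.mem_range.1 hi))
    · exact hω i (Finset.mem_range.1 hi)
  refine (measure_mono_ae hsub).trans
    (((hB.hasGaussianLaw_sum_increment m hs (N + 1)).measure_ge_le_exp
      (by norm_num : (0 : ℝ) ≤ 1 / 2) z).trans_eq ?_)
  rw [hB.variance_sum_increment m hab hmono hs, hB.integral_sum_increment m hs, hM, hz', hu, hv]
  congr 2
  field_simp
  ring

end IsBrownianBridge

/-- The energy of the polygonal line inscribed in the parabola `-s²` at unit steps. -/
lemma sum_sq_chord_slope (p : ℝ) (n : ℕ) :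
    ∑ i ∈ Finset.range n, (2 * p + 2 * i + 1) ^ 2 =
      4 * ((p + n) ^ 3 - p ^ 3) / 3 - n / 3 := by
  induction n with
  | zero => simp
  | succ k ih =>
    rw [Finset.sum_range_succ, ih]
    push_cast
    ring

/-- A Brownian bridge stays above the parabola `-s² + αs` at the points `p, p + 1, …, p + n`
with probability at most the exponential of minus the relative energy of the polygonal line
through the corresponding points of the parabola. -/
lemma IsBrownianBridge.measure_above_parabola_le {Ω : Type*} [MeasurableSpace Ω]
    {P : Measure Ω} [IsProbabilityMeasure P] {B : ℝ → Ω → ℝ} {l α x y p : ℝ} {n : ℕ}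
    (hB : IsBrownianBridge P B 0 l x (y + (-l ^ 2 + α * l))) (hn : 0 < n) (hp : 0 < p)
    (hr : p + n < l) (hx : x ≤ p ^ 2 + p) (hy : y ≤ (l - (p + n)) ^ 2 + (l - (p + n))) :
    P {ω | ∀ i : ℕ, i ≤ n → -(p + i) ^ 2 + α * (p + i) ≤ B (p + i) ω} ≤
      ENNReal.ofReal (Real.exp
        (-((x + p ^ 2) ^ 2 / (4 * p) + (((p + n) ^ 3 - p ^ 3) / 3 - n / 12) +
          (l ^ 2 - (p + n) ^ 2 - y) ^ 2 / (4 * (l - (p + n))) -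
          (x - y + l ^ 2) ^ 2 / (4 * l)))) := by
  have hr0 : 0 < l - (p + n) := by linarith
  have hl : 0 < l := by
    have : (0 : ℝ) ≤ n := n.cast_nonneg
    linarith
  let s : ℕ → ℝ := fun i => if i = 0 then 0 else if i ≤ n + 1 then p + (i - 1) else l
  let h : ℕ → ℝ := fun i =>
    if i = 0 then x else if i ≤ n + 1 then -(p + (i - 1)) ^ 2 else y - l ^ 2
  let m : ℕ → ℝ := fun i =>
    if i = 0 then -(x + p ^ 2) / p else if i ≤ n then -(2 * p + 2 * (i - 1) + 1)
    else -(l ^ 2 - (p + n) ^ 2 - y) / (l - (p + n))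
  have hs0 : s 0 = 0 := if_pos rfl
  have hs1 : ∀ i, i ≤ n → s (i + 1) = p + i := fun i hi => by simp [s, hi]
  have hs2 : ∀ i, n + 1 < i → s i = l := fun i hi => by
    simp [s, show i ≠ 0 by lia, not_le.2 hi]
  have hh0 : h 0 = x := if_pos rfl
  have hh1 : ∀ i, i ≤ n → h (i + 1) = -(p + i) ^ 2 := fun i hi => by simp [h, hi]
  have hh2 : h (n + 2) = y - l ^ 2 := by simp [h]
  have hm0 : m 0 = -(x + p ^ 2) / p := if_pos rfl
  have hm1 : ∀ i, i < n → m (i + 1) = -(2 * p + 2 * i + 1) := fun i hi => by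
    simp [m, Nat.succ_le_iff.2 hi]
  have hm2 : m (n + 1) = -(l ^ 2 - (p + n) ^ 2 - y) / (l - (p + n)) := by simp [m]
  have hmono : Monotone s := by
    refine monotone_nat_of_le_succ fun i => ?_
    rcases i with _ | i
    · rw [hs0, hs1 0 (Nat.zero_le _)]
      simpa using hp.le
    · rcases lt_trichotomy i n with hi | rfl | hi
      · rw [hs1 i hi.le, hs1 (i + 1) hi]
        push_cast
        linarith
      · rw [hs1 i le_rfl, hs2 (i + 1 + 1) (by lia)]
        exact hr.le
      · rw [hs2 _ (by lia), hs2 _ (by lia)]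
  have hslope : ∀ i ≤ n + 1, h (i + 1) - h i = m i * (s (i + 1) - s i) := by
    intro i hi
    rcases i with _ | i
    · rw [hs0, hs1 0 (Nat.zero_le _), hh0, hh1 0 (Nat.zero_le _), hm0]
      field_simp
      push_cast
      ring
    · rcases (Nat.le_of_succ_le_succ hi).lt_or_eq with hi | rfl
      · rw [hs1 i hi.le, hs1 (i + 1) hi, hh1 i hi.le, hh1 (i + 1) hi, hm1 i hi]
        push_cast
        ring
      · rw [hs1 i le_rfl, hs2 (i + 1 + 1) (by lia), hh1 i le_rfl, hh2, hm2,
          div_mul_cancel₀ _ hr0.ne']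
        ring
  have hconc : ∀ i < n + 1, m (i + 1) ≤ m i := by
    intro i hi
    rcases i with _ | i
    · rw [hm0, hm1 0 hn, le_div_iff₀ hp]
      push_cast
      nlinarith
    · rcases (Nat.lt_succ_iff.1 hi).lt_or_eq with hi | hi
      · rw [hm1 i (by lia), hm1 (i + 1) hi]
        push_cast
        linarith
      · subst hi
        rw [hm1 i (by lia), hm2, div_le_iff₀ hr0]
        push_cast at hy hr0 ⊢
        nlinarith
  have hsum : ∑ i ∈ Finset.range (n + 1 + 1), m i ^ 2 * (s (i + 1) - s i) =
      (x + p ^ 2) ^ 2 / p + (4 * ((p + n) ^ 3 - p ^ 3) / 3 - n / 3) +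
        (l ^ 2 - (p + n) ^ 2 - y) ^ 2 / (l - (p + n)) := by
    rw [Finset.sum_range_succ, Finset.sum_range_succ', ← sum_sq_chord_slope, hm0, hm2,
      hs2 (n + 1 + 1) (by lia), hs1 n le_rfl, hs0, hs1 0 (Nat.zero_le _),
      Finset.sum_congr rfl (g := fun i : ℕ => (2 * p + 2 * i + 1) ^ 2) fun i hi => ?_]
    · field_simp
      push_cast
      ring
    · have hi := Finset.mem_range.1 hi
      rw [hm1 i hi, hs1 i hi.le, hs1 (i + 1) hi]
      push_cast
      ring
  have key := hB.measure_above_polygon_le (s := s) (h := h) (m := m) α (n + 1) hl hmono hs0 hs2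
    (by rw [hh0]; ring) (by rw [hh2]; ring) hslope hconc
  refine (measure_mono fun ω hω i hi => ?_).trans (key.trans_eq ?_)
  · rw [hs1 i (by lia), hh1 i (by lia)]
    exact hω i (by lia)
  · rw [hsum, hh0, hh2, sub_zero]
    congr 2
    field_simp
    ring

/-- Up to an additive constant, replacing the tangency point `b` by `r ≤ b + 1` does not decrease
the energy of a segment ending on the parabola. -/
lemma chord_energy_ge {r b : ℝ} (hr : 0 < r) (hb : 0 ≤ b) (hrb : r ≤ b + 1) :
    2 / 3 * b ^ 3 - 1 / 3 ≤ (b ^ 2 + r ^ 2) ^ 2 / (4 * r) - r ^ 3 / 3 := by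
  have key : 0 ≤ (b - r) ^ 3 * (3 * b + r) + 4 * r := by
    rcases le_total r b with h | h
    · have := sub_nonneg.2 h
      positivity
    · have h1 : (r - b) ^ 3 ≤ 1 := pow_le_one₀ (by linarith) (by linarith)
      have h2 : 0 ≤ (r - b) ^ 3 := pow_nonneg (by linarith) 3
      nlinarith [mul_le_mul_of_nonneg_right h1 (by positivity : 0 ≤ 3 * b + r)]
  rw [← sub_nonneg]
  have : (b ^ 2 + r ^ 2) ^ 2 / (4 * r) - r ^ 3 / 3 - (2 / 3 * b ^ 3 - 1 / 3) =
      ((b - r) ^ 3 * (3 * b + r) + 4 * r) / (12 * r) := by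
    field_simp
    ring
  rw [this]
  positivity

lemma Jfun_sq_eq {a b l : ℝ} (ha : 0 ≤ a) (hb : 0 ≤ b) :
    Jfun (a ^ 2) (b ^ 2) l = 2 / 3 * a ^ 3 + (l - b) ^ 2 * b + 1 / 3 * (l - b) ^ 3 -
      (a ^ 2 - b ^ 2 + l ^ 2) ^ 2 / (4 * l) := by
  have h : (a ^ 2) ^ (3 / 2 : ℝ) = a ^ 3 := by
    rw [← Real.rpow_natCast, ← Real.rpow_mul ha, ← Real.rpow_natCast]
    norm_num
  rw [Jfun, Efun, Real.sqrt_sq hb, h]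

/-- `J` is at most linear when the two tangency points are at bounded distance. -/
lemma Jfun_sq_le {a b l : ℝ} (hl : 0 < l) (ha : 0 ≤ a) (hb : 0 ≤ b) (hal : a < l / 2)
    (hbl : b < l / 2) (h : l ≤ a + b + 2) : Jfun (a ^ 2) (b ^ 2) l ≤ 2 * l := by
  rw [Jfun_sq_eq ha hb]
  obtain ⟨c, rfl⟩ : ∃ c, a = l / 2 - c := ⟨l / 2 - a, by ring⟩
  obtain ⟨d, rfl⟩ : ∃ d, b = l / 2 - d := ⟨l / 2 - b, by ring⟩
  have hc : 0 < c := by linarith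
  have hd : 0 < d := by linarith
  have heq : 2 / 3 * (l / 2 - c) ^ 3 + (l - (l / 2 - d)) ^ 2 * (l / 2 - d) +
      1 / 3 * (l - (l / 2 - d)) ^ 3 -
      ((l / 2 - c) ^ 2 - (l / 2 - d) ^ 2 + l ^ 2) ^ 2 / (4 * l) =
      l * (c ^ 2 + d ^ 2) / 2 - 2 / 3 * (c ^ 3 + d ^ 3) -
        ((l / 2 - c) ^ 2 - (l / 2 - d) ^ 2) ^ 2 / (4 * l) := by
    field_simp
    ring
  have h1 : 0 ≤ ((l / 2 - c) ^ 2 - (l / 2 - d) ^ 2) ^ 2 / (4 * l) := by positivity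
  have h2 : 0 ≤ c ^ 3 + d ^ 3 := by positivity
  have h3 : c ^ 2 + d ^ 2 ≤ 4 := by nlinarith [mul_pos hc hd]
  have h4 : l * (c ^ 2 + d ^ 2) ≤ l * 4 := mul_le_mul_of_nonneg_left h3 hl.le
  rw [heq]
  linarith

/-- The energy of the inscribed polygonal line exceeds `J` up to a linear error. -/
lemma Jfun_sq_le_polygon_energy {a b l : ℝ} {n : ℕ} (ha : 0 ≤ a) (hb : 0 ≤ b) (hl : 1 < l)
    (hn : n ≤ l) (hr : a + 1 + n < l) (hrb : l - (a + 1 + n) ≤ b + 1) :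
    Jfun (a ^ 2) (b ^ 2) l - 2 * l ≤
      (a ^ 2 + (a + 1) ^ 2) ^ 2 / (4 * (a + 1)) +
        (((a + 1 + n) ^ 3 - (a + 1) ^ 3) / 3 - n / 12) +
        (l ^ 2 - (a + 1 + n) ^ 2 - b ^ 2) ^ 2 / (4 * (l - (a + 1 + n))) -
        (a ^ 2 - b ^ 2 + l ^ 2) ^ 2 / (4 * l) := by
  rw [Jfun_sq_eq ha hb]
  have h1 := chord_energy_ge (by positivity : 0 < a + 1) ha le_rfl
  have h2 := chord_energy_ge (sub_pos.2 hr) hb hrb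
  obtain ⟨r, hr'⟩ : ∃ r, r = l - (a + 1 + n) := ⟨_, rfl⟩
  rw [← hr'] at h2 ⊢
  have hq : a + 1 + n = l - r := by linarith
  have hr0 : r ≠ 0 := by linarith
  rw [hq]
  have h3 : (l ^ 2 - (l - r) ^ 2 - b ^ 2) ^ 2 / (4 * r) =
      l ^ 2 * r - l * (r ^ 2 + b ^ 2) + (b ^ 2 + r ^ 2) ^ 2 / (4 * r) := by
    field_simp
    ring
  rw [h3]
  linarith

lemma two_mul_le_mul_log {l : ℝ} (hl : 1 < l) : 2 * l ≤ 4 * l * Real.log (1 + l) := by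
  have h1 : Real.log 2 ≤ Real.log (1 + l) := Real.log_le_log (by norm_num) (by linarith)
  nlinarith [Real.log_two_gt_d9]

/-- **Parabola avoidance upper bound** (Lemma 4.5.1 of the paper).
There is a universal constant `c > 0` such that for every `λ > 1`, `α ∈ ℝ`,
`f(s) = −s² + αs`, every `x, y > 0` with `√x < λ/2`, `√y < λ/2`, and every
`t ∈ [0, √x + 1]`: if `B` is a Brownian bridge of variance `2` from `(0, x)` to
`(λ, y + f(λ))`, then `P(B(s) > f(s) ∀ s ∈ [t, λ]) ≤ exp(−J(x, y, λ) + c λ log(1 + λ))`. -/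
theorem parabola_avoidance_upper_bound :
    ∃ c : ℝ, 0 < c ∧
      ∀ (Ω : Type) [MeasurableSpace Ω] (P : Measure Ω) [IsProbabilityMeasure P]
        (l α x y t : ℝ), 1 < l → 0 < x → 0 < y →
        Real.sqrt x < l / 2 → Real.sqrt y < l / 2 →
        t ∈ Set.Icc 0 (Real.sqrt x + 1) →
        ∀ B : ℝ → Ω → ℝ,
          IsBrownianBridge P B 0 l x (y + (-l ^ 2 + α * l)) →
          P {ω | ∀ s ∈ Set.Icc t l, -s ^ 2 + α * s < B s ω} ≤
            ENNReal.ofReal (Real.exp (-Jfun x y l + c * l * Real.log (1 + l))) := by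
  refine ⟨4, by norm_num, ?_⟩
  intro Ω _ P _ l α x y t hl hx hy hxl hyl ht B hB
  have hlog := two_mul_le_mul_log hl
  set a : ℝ := Real.sqrt x
  set b : ℝ := Real.sqrt y
  have ha : 0 ≤ a := Real.sqrt_nonneg x
  have hb : 0 ≤ b := Real.sqrt_nonneg y
  have hxa : x = a ^ 2 := (Real.sq_sqrt hx.le).symm
  have hyb : y = b ^ 2 := (Real.sq_sqrt hy.le).symm
  clear_value a b
  subst hxa hyb
  rcases lt_or_ge (l - b) (a + 1 + 1) with hshort | hlong
  · refine prob_le_one.trans ?_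
    have hJ := Jfun_sq_le (by linarith) ha hb hxl hyl (by linarith)
    rw [ENNReal.one_le_ofReal, Real.one_le_exp_iff]
    linarith
  · set n : ℕ := ⌊l - b - (a + 1)⌋₊ with hn_def
    have hn : 0 < n := Nat.floor_pos.2 (by linarith)
    have hn1 : (n : ℝ) ≤ l - b - (a + 1) := Nat.floor_le (by linarith)
    have hn2 : l - b - (a + 1) < n + 1 := Nat.lt_floor_add_one _
    have hb0 : 0 < b := by nlinarith
    have hr : a + 1 + n < l := by linarith
    have hE := Jfun_sq_le_polygon_energy ha hb hl (by linarith) hr (by linarith)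
    refine (measure_mono fun ω hω i hi => ?_).trans
      ((hB.measure_above_parabola_le hn (by linarith) hr (by nlinarith) ?_).trans
        (ENNReal.ofReal_le_ofReal (Real.exp_le_exp.2 (by linarith))))
    · have hi' : (i : ℝ) ≤ n := Nat.cast_le.2 hi
      have hi0 : (0 : ℝ) ≤ i := i.cast_nonneg
      exact (hω (a + 1 + i) ⟨by linarith [ht.2], by linarith⟩).le
    · have hbr : b ≤ l - (a + 1 + n) := by linarith
      nlinarith
end

section
/- Let t > 0 and let B be a Brownian motion of variance 2 on [0, t]. Let a, b ≥ 0, and let A ⊆ [−b, a] be a Borel set. Then P( sup_{s ∈ [0,t]} B(s) ≥ a, inf_{s ∈ [0,t]} B(s) ≤ −b, and B(t) ∈ A ) ≤ ∫_A (4πt)^{−1/2}·[ exp(−(2a + 2b − x)²/(4t)) + exp(−(2a + 2b + x)²/(4t)) ] dx. -/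
open MeasureTheory ProbabilityTheory

/-- `IsBrownianMotion2 P B t` says that, under the probability measure `P`, the process
`B` is a Brownian motion of variance `2` on `[0, t]`: a continuous centered Gaussian
process with `B 0 = 0` and covariance `Cov(B r, B s) = 2 min(r, s)`. -/
structure IsBrownianMotion2 {Ω : Type*} [MeasurableSpace Ω] (P : Measure Ω)
    (B : ℝ → Ω → ℝ) (t : ℝ) : Prop where
  meas : ∀ s, Measurable (B s)
  cont : ∀ᵐ ω ∂P, ContinuousOn (fun s => B s ω) (Set.Icc 0 t)
  start : ∀ᵐ ω ∂P, B 0 ω = 0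
  gaussian : ∀ (n : ℕ) (s c : Fin n → ℝ), (∀ i, s i ∈ Set.Icc 0 t) →
      ∃ (μ : ℝ) (V : NNReal),
        P.map (fun ω => ∑ i, c i * B (s i) ω) = gaussianReal μ V
  mean : ∀ s ∈ Set.Icc 0 t, ∫ ω, B s ω ∂P = 0
  cov : ∀ r s : ℝ, r ∈ Set.Icc 0 t → s ∈ Set.Icc 0 t →
      ∫ ω, B r ω * B s ω ∂P = 2 * min r s

namespace IsBrownianMotion2

open Filter Topology
open scoped NNReal ENNReal

variable {Ω : Type*} [MeasurableSpace Ω] {P : Measure Ω} {B : ℝ → Ω → ℝ} {t : ℝ}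

lemma isGaussianProcess (hB : IsBrownianMotion2 P B t) :
    IsGaussianProcess (fun s : Set.Icc (0 : ℝ) t ↦ B s) P where
  hasGaussianLaw I := by
    refine ⟨isGaussian_of_map_eq_gaussianReal fun L ↦ ?_⟩
    classical
    obtain ⟨μ, V, h⟩ := hB.gaussian I.card (fun i ↦ (I.equivFin.symm i : Set.Icc (0 : ℝ) t))
      (fun i ↦ L (Pi.single (I.equivFin.symm i) 1)) (fun i ↦ (I.equivFin.symm i).1.2)
    refine ⟨μ, V, ?_⟩
    have hmeas : Measurable fun ω ↦ I.restrict (fun s : Set.Icc (0 : ℝ) t ↦ B s ω) :=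
      measurable_pi_lambda _ fun _ ↦ hB.meas _
    rw [Measure.map_map L.continuous.measurable hmeas, ← h]
    congr 1
    ext ω
    rw [I.equivFin.symm.sum_comp (fun s : I ↦ L (Pi.single s 1) * B s ω), Function.comp_apply]
    conv_lhs => rw [pi_eq_sum_univ (I.restrict fun s : Set.Icc (0 : ℝ) t ↦ B s ω), map_sum]
    refine Finset.sum_congr rfl fun s _ ↦ ?_
    rw [map_smul, smul_eq_mul, mul_comm]
    congr 2
    ext j
    simp [Pi.single_apply, eq_comm]

lemma neg (hB : IsBrownianMotion2 P B t) : IsBrownianMotion2 P (fun s ω ↦ -B s ω) t where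
  meas s := (hB.meas s).neg
  cont := hB.cont.mono fun _ h ↦ h.neg
  start := hB.start.mono fun _ h ↦ by simp [h]
  gaussian n s c hs := by simpa using hB.gaussian n s (-c) hs
  mean s hs := by simp [integral_neg, hB.mean s hs]
  cov r s hr hs := by simpa using hB.cov r s hr hs

lemma hasGaussianLaw_eval (hB : IsBrownianMotion2 P B t) {s : ℝ} (hs : s ∈ Set.Icc 0 t) :
    HasGaussianLaw (B s) P :=
  hB.isGaussianProcess.hasGaussianLaw_eval ⟨s, hs⟩

lemma covariance_eval [IsProbabilityMeasure P] (hB : IsBrownianMotion2 P B t) {r s : ℝ}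
    (hr : r ∈ Set.Icc 0 t) (hs : s ∈ Set.Icc 0 t) : cov[B r, B s; P] = 2 * min r s := by
  rw [covariance_eq_sub (hB.hasGaussianLaw_eval hr).memLp_two
    (hB.hasGaussianLaw_eval hs).memLp_two, hB.mean r hr, hB.mean s hs, ← hB.cov r s hr hs]
  simp

lemma map_sub_eq_gaussianReal [IsProbabilityMeasure P] (hB : IsBrownianMotion2 P B t) {r s : ℝ}
    (hr : r ∈ Set.Icc 0 t) (hs : s ∈ Set.Icc 0 t) (hrs : r ≤ s) :
    P.map (B s - B r) = gaussianReal 0 (2 * (s - r)).toNNReal := by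
  have hrL := hB.hasGaussianLaw_eval hr
  have hsL := hB.hasGaussianLaw_eval hs
  have h : HasGaussianLaw (B s - B r) P :=
    hB.isGaussianProcess.hasGaussianLaw_sub (s := ⟨s, hs⟩) (t := ⟨r, hr⟩)
  rw [h.map_eq_gaussianReal]
  congr 2
  · simp only [Pi.sub_apply]
    rw [integral_sub hsL.integrable hrL.integrable, hB.mean s hs, hB.mean r hr, sub_zero]
  · rw [← covariance_self h.aemeasurable, covariance_sub_sub hsL.memLp_two hrL.memLp_two
      hsL.memLp_two hrL.memLp_two]
    simp only [hB.covariance_eval, hr, hs, min_self, min_eq_left hrs, min_eq_right hrs]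
    ring

lemma indepFun_past_increment [IsProbabilityMeasure P] (hB : IsBrownianMotion2 P B t)
    {g : ℕ → ℝ} (hg : ∀ k, g k ∈ Set.Icc 0 t) (hmono : Monotone g) (k : ℕ) :
    IndepFun (fun ω (i : Set.Iic k) ↦ B (g i) ω) (B (g (k + 1)) - B (g k)) P := by
  have h : IndepFun (fun ω (i : Set.Iic k) ↦ B (g i) ω)
      (fun ω (_ : Unit) ↦ (B (g (k + 1)) - B (g k)) ω) P := by
    refine IsGaussianProcess.indepFun_of_covariance_eq_zero (X := fun (i : Set.Iic k) ↦ B (g i))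
      (Y := fun _ : Unit ↦ B (g (k + 1)) - B (g k)) ?_ (fun _ ↦ (hB.meas _).aemeasurable)
      (fun _ ↦ ((hB.meas _).sub (hB.meas _)).aemeasurable) ?_
    · classical
      refine hB.isGaussianProcess.of_isGaussianProcess ?_
      rintro (i | i)
      · exact ⟨{⟨g i, hg i⟩}, .proj ⟨⟨g i, hg i⟩, by simp⟩, fun ω ↦ by simp⟩
      · refine ⟨{⟨g (k + 1), hg _⟩, ⟨g k, hg _⟩},
          .proj ⟨⟨g (k + 1), hg _⟩, by simp⟩ - .proj ⟨⟨g k, hg _⟩, by simp⟩, fun ω ↦ by simp⟩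
    · rintro ⟨i, hi⟩ -
      have hL := fun k ↦ (hB.hasGaussianLaw_eval (hg k)).memLp_two
      rw [covariance_sub_right (hL _) (hL _) (hL _), hB.covariance_eval (hg _) (hg _),
        hB.covariance_eval (hg _) (hg _), min_eq_left (hmono hi),
        min_eq_left (hmono (le_trans hi k.le_succ)), sub_self]
  exact h.comp measurable_id (measurable_pi_apply ())

end IsBrownianMotion2

section Reflection

open Filter Topology
open scoped NNReal ENNReal

variable {Ω : Type*} [mΩ : MeasurableSpace Ω] {P : Measure Ω}

lemma map_add_sign_mul_eq_gaussianReal {Y S D : Ω → ℝ} [IsProbabilityMeasure P] {v w : ℝ≥0}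
    (hY : Measurable Y) (hS : Measurable S) (hD : Measurable D)
    (hS1 : ∀ ω, S ω = 1 ∨ S ω = -1) (hind : IndepFun (fun ω ↦ (Y ω, S ω)) D P)
    (hYlaw : P.map Y = gaussianReal 0 v) (hDlaw : P.map D = gaussianReal 0 w) :
    P.map (fun ω ↦ Y ω + S ω * D ω) = gaussianReal 0 (v + w) := by
  have hYS : MeasurePreserving (fun ω ↦ (Y ω, S ω)) P (P.map fun ω ↦ (Y ω, S ω)) :=
    (hY.prodMk hS).measurePreserving _
  have hfst : MeasurePreserving Prod.fst (P.map fun ω ↦ (Y ω, S ω)) (gaussianReal 0 v) := by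
    refine ⟨measurable_fst, ?_⟩
    rw [Measure.map_map measurable_fst (hY.prodMk hS), ← hYlaw]
    rfl
  have hprod : MeasurePreserving (fun ω ↦ ((Y ω, S ω), D ω)) P
      ((P.map fun ω ↦ (Y ω, S ω)).prod (gaussianReal 0 w)) := by
    refine ⟨(hY.prodMk hS).prodMk hD, ?_⟩
    rw [hind.map_prod_eq_prod_map_map (hY.prodMk hS).aemeasurable hD.aemeasurable, hDlaw]
  have hskew : MeasurePreserving (fun p : (ℝ × ℝ) × ℝ ↦ (p.1.1, p.1.2 * p.2))
      ((P.map fun ω ↦ (Y ω, S ω)).prod (gaussianReal 0 w))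
      ((gaussianReal 0 v).prod (gaussianReal 0 w)) := by
    refine hfst.skew_product (g := fun a x ↦ a.2 * x) (by fun_prop) ?_
    have hsign : MeasurableSet {p : ℝ × ℝ | p.2 = 1 ∨ p.2 = -1} :=
      measurable_snd (Set.toFinite {1, -1}).measurableSet
    filter_upwards [(ae_map_iff (hY.prodMk hS).aemeasurable hsign).2 (ae_of_all _ hS1)] with p hp
    rcases hp with h | h
    · simp [h, Measure.map_id']
    · simp [h, gaussianReal_map_neg]
  have hadd : MeasurePreserving (fun p : ℝ × ℝ ↦ p.1 + p.2)
      ((gaussianReal 0 v).prod (gaussianReal 0 w)) (gaussianReal 0 (v + w)) := by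
    refine ⟨by fun_prop, ?_⟩
    have := gaussianReal_conv_gaussianReal (m₁ := 0) (m₂ := 0) (v₁ := v) (v₂ := w)
    rwa [Measure.conv, add_zero] at this
  exact (hadd.comp (hskew.comp hprod)).map_eq

lemma map_sum_sign_mul_increment_eq_gaussianReal [IsProbabilityMeasure P] (ℱ : Filtration ℕ mΩ)
    {X S : ℕ → Ω → ℝ} {v : ℕ → ℝ≥0} (hX : ∀ k, Measurable[ℱ k] (X k))
    (hS : ∀ k, Measurable[ℱ k] (S k)) (hS1 : ∀ k ω, S k ω = 1 ∨ S k ω = -1)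
    (hind : ∀ k, Indep (ℱ k) (MeasurableSpace.comap (X (k + 1) - X k) inferInstance) P)
    (hlaw : ∀ k, P.map (X (k + 1) - X k) = gaussianReal 0 (v k)) (n : ℕ) :
    P.map (fun ω ↦ ∑ k ∈ Finset.range n, S k ω * (X (k + 1) ω - X k ω)) =
      gaussianReal 0 (∑ k ∈ Finset.range n, v k) := by
  induction n with
  | zero => simp
  | succ n ih =>
    have hY : Measurable[ℱ n]
        (fun ω ↦ ∑ k ∈ Finset.range n, S k ω * (X (k + 1) ω - X k ω)) := by
      refine Finset.measurable_fun_sum _ fun k hk ↦ ?_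
      have hk' : k + 1 ≤ n := Finset.mem_range.1 hk
      exact ((hS k).mono (ℱ.mono (by omega)) le_rfl).mul
        (((hX (k + 1)).mono (ℱ.mono hk') le_rfl).sub ((hX k).mono (ℱ.mono (by omega)) le_rfl))
    have hYS : Measurable[ℱ n]
        (fun ω ↦ (∑ k ∈ Finset.range n, S k ω * (X (k + 1) ω - X k ω), S n ω)) :=
      hY.prodMk (hS n)
    simp only [Finset.sum_range_succ]
    refine map_add_sign_mul_eq_gaussianReal (D := X (n + 1) - X n) (hY.mono (ℱ.le n) le_rfl)
      ((hS n).mono (ℱ.le n) le_rfl)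
      (((hX _).mono (ℱ.le _) le_rfl).sub ((hX _).mono (ℱ.le _) le_rfl)) (hS1 n) ?_ ih (hlaw n)
    exact indep_of_indep_of_le_left (hind n) hYS.comap_le

/-- The sequence `x` reaches `[α, ∞)` at some index at most `k`. -/
def HitsAbove (α : ℝ) (x : ℕ → ℝ) (k : ℕ) : Prop := ∃ i ≤ k, α ≤ x i

/-- The sequence `x` reaches `[α, ∞)` and then `(-∞, β]` by the index `k`. -/
def HitsAboveThenBelow (α β : ℝ) (x : ℕ → ℝ) (k : ℕ) : Prop :=
  ∃ j ≤ k, x j ≤ β ∧ HitsAbove α x j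

lemma hitsAbove_succ {α : ℝ} {x : ℕ → ℝ} {k : ℕ} :
    HitsAbove α x (k + 1) ↔ HitsAbove α x k ∨ α ≤ x (k + 1) := by
  simp [HitsAbove, Nat.le_succ_iff, or_and_right, exists_or]

lemma hitsAboveThenBelow_succ {α β : ℝ} {x : ℕ → ℝ} {k : ℕ} :
    HitsAboveThenBelow α β x (k + 1) ↔
      HitsAboveThenBelow α β x k ∨ (x (k + 1) ≤ β ∧ HitsAbove α x (k + 1)) := by
  simp [HitsAboveThenBelow, Nat.le_succ_iff, or_and_right, exists_or]

lemma HitsAboveThenBelow.hitsAbove {α β : ℝ} {x : ℕ → ℝ} {k : ℕ}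
    (h : HitsAboveThenBelow α β x k) : HitsAbove α x k := by
  obtain ⟨j, hj, -, i, hi, hx⟩ := h
  exact ⟨i, hi.trans hj, hx⟩

open Classical in
/-- The sign by which the double reflection multiplies the increment `x (k + 1) - x k`: it is `-1`
between the first visit of `[α, ∞)` and the following first visit of `(-∞, β]`. -/
noncomputable def reflectionSign (α β : ℝ) (x : ℕ → ℝ) (k : ℕ) : ℝ :=
  if HitsAbove α x k ∧ ¬HitsAboveThenBelow α β x k then -1 else 1

/-- The value at `n` of the doubly reflected sequence. -/
noncomputable def doubleReflection (α β : ℝ) (x : ℕ → ℝ) (n : ℕ) : ℝ :=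
  ∑ k ∈ Finset.range n, reflectionSign α β x k * (x (k + 1) - x k)

lemma abs_doubleReflection_sub_le {a b δ : ℝ} (ha : 0 ≤ a) (hb : 0 ≤ b) (hδ : 0 ≤ δ) {x : ℕ → ℝ}
    (hx0 : x 0 = 0) (hx : ∀ k, |x (k + 1) - x k| ≤ δ) {n : ℕ}
    (hn : HitsAboveThenBelow (a - δ) (-b + δ) x n) :
    |doubleReflection (a - δ) (-b + δ) x n - 2 * (a + b) - x n| ≤ 4 * δ := by
  set α := a - δ
  set β := -b + δ
  have key : ∀ k, (¬HitsAbove α x k → doubleReflection α β x k = x k) ∧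
      (HitsAbove α x k → ¬HitsAboveThenBelow α β x k →
        ∃ u, α ≤ u ∧ u ≤ a ∧ doubleReflection α β x k = 2 * u - x k) ∧
      (HitsAboveThenBelow α β x k → ∃ u v, α ≤ u ∧ u ≤ a ∧ -b - δ ≤ v ∧ v ≤ β ∧
        doubleReflection α β x k = x k + 2 * (u - v)) := by
    intro k
    induction k with
    | zero =>
      have h0 : doubleReflection α β x 0 = 0 := by simp [doubleReflection]
      refine ⟨fun _ ↦ by rw [h0, hx0], fun h _ ↦ ?_, fun h ↦ ?_⟩
      · obtain ⟨i, hi, h⟩ := h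
        obtain rfl : i = 0 := by omega
        exact ⟨0, by rwa [hx0] at h, ha, by rw [h0, hx0]; ring⟩
      · obtain ⟨j, hj, h', i, hi, h⟩ := h
        obtain rfl : j = 0 := by omega
        obtain rfl : i = 0 := by omega
        rw [hx0] at h h'
        exact ⟨0, 0, h, ha, by linarith, h', by rw [h0, hx0]; ring⟩
    | succ k ih =>
      have hs : doubleReflection α β x (k + 1) =
          doubleReflection α β x k + reflectionSign α β x k * (x (k + 1) - x k) :=
        Finset.sum_range_succ _ _
      obtain ⟨ih1, ih2, ih3⟩ := ih
      have hxk := abs_le.1 (hx k)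
      by_cases hQ : HitsAboveThenBelow α β x k
      · have hP := hQ.hitsAbove
        obtain ⟨u, v, h1, h2, h3, h4, h5⟩ := ih3 hQ
        rw [reflectionSign, if_neg (by tauto), h5] at hs
        exact ⟨fun h ↦ absurd (hitsAbove_succ.2 (.inl hP)) h,
          fun _ h ↦ absurd (hitsAboveThenBelow_succ.2 (.inl hQ)) h,
          fun _ ↦ ⟨u, v, h1, h2, h3, h4, by linarith⟩⟩
      by_cases hP : HitsAbove α x k
      · obtain ⟨u, h1, h2, h5⟩ := ih2 hP hQ
        rw [reflectionSign, if_pos ⟨hP, hQ⟩, h5] at hs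
        have hxβ : β < x k := by
          by_contra! h
          exact hQ ⟨k, le_rfl, h, hP⟩
        refine ⟨fun h ↦ absurd (hitsAbove_succ.2 (.inl hP)) h, fun _ _ ↦ ⟨u, h1, h2, by linarith⟩,
          fun h ↦ ?_⟩
        obtain ⟨h, -⟩ := (hitsAboveThenBelow_succ.1 h).resolve_left hQ
        exact ⟨u, x (k + 1), h1, h2, by linarith, h, by linarith⟩
      · have hxα : x k < α := by
          by_contra! h
          exact hP ⟨k, le_rfl, h⟩
        rw [reflectionSign, if_neg (by tauto), ih1 hP] at hs
        refine ⟨fun _ ↦ by linarith, fun h _ ↦ ?_, fun h ↦ ?_⟩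
        · have h := (hitsAbove_succ.1 h).resolve_left hP
          exact ⟨x (k + 1), h, by linarith, by linarith⟩
        · obtain ⟨h', h⟩ := (hitsAboveThenBelow_succ.1 h).resolve_left hQ
          have h := (hitsAbove_succ.1 h).resolve_left hP
          exact ⟨x (k + 1), x (k + 1), h, by linarith, by linarith, h', by linarith⟩
  obtain ⟨u, v, h1, h2, h3, h4, h5⟩ := (key n).2.2 hn
  rw [h5, abs_le]
  constructor <;> linarith

lemma measurable_reflectionSign (ℱ : Filtration ℕ mΩ) {X : ℕ → Ω → ℝ}
    (hX : ∀ k, Measurable[ℱ k] (X k)) (α β : ℝ) (k : ℕ) :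
    Measurable[ℱ k] fun ω ↦ reflectionSign α β (fun i ↦ X i ω) k := by
  have hX' : ∀ i ≤ k, Measurable[ℱ k] (X i) := fun i hi ↦ (hX i).mono (ℱ.mono hi) le_rfl
  have hP : ∀ j ≤ k, MeasurableSet[ℱ k] {ω | HitsAbove α (fun i ↦ X i ω) j} := by
    intro j hj
    have : {ω | HitsAbove α (fun i ↦ X i ω) j} = ⋃ i ∈ Set.Iic j, {ω | α ≤ X i ω} := by
      ext ω
      simp [HitsAbove]
    rw [this]
    exact .biUnion (Set.to_countable _) fun i hi ↦
      measurableSet_le measurable_const (hX' i (le_trans hi hj))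
  have hQ : MeasurableSet[ℱ k] {ω | HitsAboveThenBelow α β (fun i ↦ X i ω) k} := by
    have : {ω | HitsAboveThenBelow α β (fun i ↦ X i ω) k} =
        ⋃ j ∈ Set.Iic k, {ω | X j ω ≤ β} ∩ {ω | HitsAbove α (fun i ↦ X i ω) j} := by
      ext ω
      simp [HitsAboveThenBelow]
      exact exists_congr fun _ ↦ and_left_comm
    rw [this]
    exact .biUnion (Set.to_countable _) fun j hj ↦
      (measurableSet_le (hX' j hj) measurable_const).inter (hP j hj)
  exact .ite ((hP k le_rfl).inter hQ.compl) measurable_const measurable_const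

/-- The uniform subdivision of `[0, t]` into `N + 1` intervals, constant after the index `N + 1`. -/
noncomputable def uniformGrid (t : ℝ) (N k : ℕ) : ℝ := min (k * (t / (N + 1))) t

lemma uniformGrid_mem_Icc {t : ℝ} (ht : 0 ≤ t) (N k : ℕ) : uniformGrid t N k ∈ Set.Icc 0 t :=
  ⟨le_min (by positivity) ht, min_le_right _ _⟩

lemma monotone_uniformGrid {t : ℝ} (ht : 0 ≤ t) (N : ℕ) : Monotone (uniformGrid t N) :=
  fun i j hij ↦ min_le_min_right _ (by gcongr)

lemma uniformGrid_zero {t : ℝ} (ht : 0 ≤ t) (N : ℕ) : uniformGrid t N 0 = 0 := by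
  simp [uniformGrid, ht]

lemma uniformGrid_last (t : ℝ) (N : ℕ) : uniformGrid t N (N + 1) = t := by
  simp [uniformGrid, mul_div_cancel₀ t (Nat.cast_add_one_ne_zero (R := ℝ) N)]

lemma uniformGrid_succ_sub_le {t : ℝ} (ht : 0 ≤ t) (N k : ℕ) :
    uniformGrid t N (k + 1) - uniformGrid t N k ≤ t / (N + 1) := by
  have h : 0 ≤ t / (N + 1) := by positivity
  simp only [uniformGrid, Nat.cast_succ, add_mul, one_mul]
  grind

lemma exists_uniformGrid_le {t s : ℝ} (ht : 0 < t) (N : ℕ) (hs : s ∈ Set.Icc 0 t) :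
    uniformGrid t N ⌊s / (t / (N + 1))⌋₊ ≤ s ∧
      s < uniformGrid t N ⌊s / (t / (N + 1))⌋₊ + t / (N + 1) ∧
      ⌊s / (t / (N + 1))⌋₊ ≤ N + 1 := by
  have hh : 0 < t / (N + 1 : ℝ) := by positivity
  set h := t / (N + 1 : ℝ)
  have h1 : ⌊s / h⌋₊ * h ≤ s := (le_div_iff₀ hh).1 (Nat.floor_le (div_nonneg hs.1 hh.le))
  have h2 : s < (⌊s / h⌋₊ + 1) * h := (div_lt_iff₀ hh).1 (Nat.lt_floor_add_one _)
  have h3 : uniformGrid t N ⌊s / h⌋₊ = ⌊s / h⌋₊ * h := min_eq_left (h1.trans hs.2)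
  refine ⟨by rwa [h3], by rw [h3]; linarith, ?_⟩
  refine Nat.floor_le_of_le ?_
  rw [div_le_iff₀ hh]
  have : ((N : ℝ) + 1) * h = t := mul_div_cancel₀ t (Nat.cast_add_one_ne_zero (R := ℝ) N)
  push_cast
  linarith [hs.2]

lemma eventually_hitsAboveThenBelow_uniformGrid {f : ℝ → ℝ} {t a b δ : ℝ} (ht : 0 < t) (hδ : 0 < δ)
    (hf : ContinuousOn f (Set.Icc 0 t)) {r s : ℝ} (hr : r ∈ Set.Icc 0 t) (hs : s ∈ Set.Icc 0 t)
    (hrs : r ≤ s) (hfr : a ≤ f r) (hfs : f s ≤ -b) :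
    ∀ᶠ N : ℕ in atTop,
      HitsAboveThenBelow (a - δ) (-b + δ) (fun k ↦ f (uniformGrid t N k)) (N + 1) ∧
      ∀ k, |f (uniformGrid t N (k + 1)) - f (uniformGrid t N k)| ≤ δ := by
  obtain ⟨η, hη, hfη⟩ := Metric.uniformContinuousOn_iff.1
    (isCompact_Icc.uniformContinuousOn_of_continuous hf) δ hδ
  have hlim : Tendsto (fun N : ℕ ↦ t / ((N : ℝ) + 1)) atTop (𝓝 0) :=
    tendsto_const_nhds.div_atTop (tendsto_atTop_add_const_right _ _ tendsto_natCast_atTop_atTop)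
  filter_upwards [hlim.eventually_lt_const hη] with N hN
  have hmem := uniformGrid_mem_Icc ht.le N
  have hclose {u : ℝ} (hu : u ∈ Set.Icc 0 t) :
      |f (uniformGrid t N ⌊u / (t / (N + 1))⌋₊) - f u| < δ := by
    obtain ⟨h1, h2, -⟩ := exists_uniformGrid_le ht N hu
    refine hfη _ (hmem _) _ hu ?_
    rw [Real.dist_eq, abs_lt]
    constructor <;> linarith
  refine ⟨⟨⌊s / (t / (N + 1))⌋₊, (exists_uniformGrid_le ht N hs).2.2, ?_,
    ⌊r / (t / (N + 1))⌋₊, by gcongr, ?_⟩, fun k ↦ ?_⟩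
  · linarith [abs_lt.1 (hclose hs)]
  · linarith [abs_lt.1 (hclose hr)]
  · refine (hfη _ (hmem _) _ (hmem _) ?_).le
    rw [Real.dist_eq, abs_of_nonneg (sub_nonneg.2 (monotone_uniformGrid ht.le N k.le_succ))]
    exact (uniformGrid_succ_sub_le ht.le N k).trans_lt hN

lemma measure_setOf_eventually_le {s : ℕ → Set Ω} {c : ℝ≥0∞} (h : ∀ n, P (s n) ≤ c) :
    P {ω | ∀ᶠ n in atTop, ω ∈ s n} ≤ c := by
  have : {ω | ∀ᶠ n in atTop, ω ∈ s n} = ⋃ N, ⋂ n ∈ Set.Ici N, s n := by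
    ext ω
    simp [eventually_atTop]
  have hmono : Monotone fun N : ℕ ↦ ⋂ n ∈ Set.Ici N, s n :=
    fun M N hMN ↦ Set.biInter_mono (Set.Ici_subset_Ici.2 hMN) fun _ _ ↦ subset_rfl
  rw [this, hmono.measure_iUnion]
  exact iSup_le fun N ↦
    (measure_mono (Set.biInter_subset_of_mem (Set.mem_Ici.2 le_rfl))).trans (h N)

end Reflection

namespace IsBrownianMotion2

open Filter Topology
open scoped NNReal ENNReal

variable {Ω : Type*} [MeasurableSpace Ω] {P : Measure Ω} [IsProbabilityMeasure P]
  {B : ℝ → Ω → ℝ} {t : ℝ}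

lemma map_doubleReflection_uniformGrid (hB : IsBrownianMotion2 P B t) (ht : 0 ≤ t) (α β : ℝ)
    (N : ℕ) :
    P.map (fun ω ↦ doubleReflection α β (fun k ↦ B (uniformGrid t N k) ω) (N + 1)) =
      gaussianReal 0 (2 * t).toNNReal := by
  have hg := uniformGrid_mem_Icc ht N
  have hmono := monotone_uniformGrid ht N
  have hmeas : ∀ k, StronglyMeasurable (B (uniformGrid t N k)) :=
    fun k ↦ (hB.meas _).stronglyMeasurable
  let ℱ : Filtration ℕ _ := Filtration.natural (fun k ↦ B (uniformGrid t N k)) hmeas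
  have hX : ∀ k, Measurable[ℱ k] (B (uniformGrid t N k)) :=
    fun k ↦ (Filtration.stronglyAdapted_natural hmeas k).measurable
  have hsum : ∀ n, ∑ k ∈ Finset.range n,
      (2 * (uniformGrid t N (k + 1) - uniformGrid t N k)).toNNReal =
        (2 * uniformGrid t N n).toNNReal := by
    intro n
    rw [← Real.toNNReal_sum_of_nonneg fun k _ ↦
      mul_nonneg zero_le_two (sub_nonneg.2 (hmono k.le_succ)), ← Finset.mul_sum,
      Finset.sum_range_sub, uniformGrid_zero ht, sub_zero]
  have := map_sum_sign_mul_increment_eq_gaussianReal ℱ (P := P) hX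
    (measurable_reflectionSign ℱ hX α β) ?_ ?_
    (fun k ↦ hB.map_sub_eq_gaussianReal (hg k) (hg (k + 1)) (hmono k.le_succ)) (N + 1)
  · rwa [hsum, uniformGrid_last] at this
  · intro k ω
    unfold reflectionSign
    split_ifs <;> simp
  · intro k
    rw [Filtration.natural_eq_comap]
    exact hB.indepFun_past_increment hg hmono k

lemma measure_up_down_isCompact_le (hB : IsBrownianMotion2 P B t) (ht : 0 < t) {a b : ℝ}
    (ha : 0 ≤ a) (hb : 0 ≤ b) {K : Set ℝ} (hK : IsCompact K) :
    P {ω | (∃ r ∈ Set.Icc 0 t, ∃ s ∈ Set.Icc 0 t, r ≤ s ∧ a ≤ B r ω ∧ B s ω ≤ -b) ∧ B t ω ∈ K} ≤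
      gaussianReal (-(2 * (a + b))) (2 * t).toNNReal K := by
  set γ := gaussianReal (-(2 * (a + b))) (2 * t).toNNReal
  have hlim : Tendsto (fun δ ↦ γ (Metric.cthickening (4 * δ) K)) (𝓝[>] 0) (𝓝 (γ K)) := by
    refine (tendsto_measure_cthickening_of_isCompact hK).comp ?_
    have : Tendsto (fun δ : ℝ ↦ 4 * δ) (𝓝 0) (𝓝 (4 * 0)) := tendsto_id.const_mul 4
    rw [mul_zero] at this
    exact this.mono_left nhdsWithin_le_nhds
  refine ge_of_tendsto hlim ?_
  filter_upwards [self_mem_nhdsWithin] with δ hδ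
  have hδ : 0 < δ := hδ
  let Y : ℕ → Ω → ℝ := fun N ω ↦
    doubleReflection (a - δ) (-b + δ) (fun k ↦ B (uniformGrid t N k) ω) (N + 1)
  have hY : ∀ N, P.map (Y N) = gaussianReal 0 (2 * t).toNNReal :=
    hB.map_doubleReflection_uniformGrid ht.le _ _
  have hYm : ∀ N, AEMeasurable (Y N) P := fun N ↦ AEMeasurable.of_map_ne_zero <| by
    rw [hY]
    exact IsProbabilityMeasure.ne_zero _
  have hYlaw : ∀ N, P {ω | Y N ω - 2 * (a + b) ∈ Metric.cthickening (4 * δ) K} =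
      γ (Metric.cthickening (4 * δ) K) := by
    intro N
    have hC := (Metric.isClosed_cthickening (δ := 4 * δ) (E := K)).measurableSet
    have hγ : γ = P.map (fun ω ↦ Y N ω - 2 * (a + b)) := by
      have h0 : γ = gaussianReal (0 - 2 * (a + b)) (2 * t).toNNReal := by rw [zero_sub]
      rw [h0, ← gaussianReal_map_sub_const, ← hY N,
        AEMeasurable.map_map_of_aemeasurable (by fun_prop) (hYm N)]
      rfl
    rw [hγ, Measure.map_apply_of_aemeasurable ((hYm N).sub_const _) hC]
    rfl
  refine le_trans (measure_mono_ae ?_) (measure_setOf_eventually_le fun N ↦ (hYlaw N).le)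
  filter_upwards [hB.cont, hB.start] with ω hcont hstart
  rintro ⟨⟨r, hr, s, hs, hrs, har, hbs⟩, hK'⟩
  have hev := eventually_hitsAboveThenBelow_uniformGrid ht hδ hcont hr hs hrs har hbs
  change ∀ᶠ N in atTop, Y N ω - 2 * (a + b) ∈ Metric.cthickening (4 * δ) K
  filter_upwards [hev] with N hN
  have h := abs_doubleReflection_sub_le ha hb hδ.le (by rw [uniformGrid_zero ht.le, hstart])
    hN.2 hN.1
  rw [uniformGrid_last] at h
  exact Metric.mem_cthickening_of_dist_le _ _ _ _ hK' h

lemma measure_up_down_le (hB : IsBrownianMotion2 P B t) (ht : 0 < t) {a b : ℝ}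
    (ha : 0 ≤ a) (hb : 0 ≤ b) {A : Set ℝ} (hA : MeasurableSet A) :
    P {ω | (∃ r ∈ Set.Icc 0 t, ∃ s ∈ Set.Icc 0 t, r ≤ s ∧ a ≤ B r ω ∧ B s ω ≤ -b) ∧ B t ω ∈ A} ≤
      gaussianReal (-(2 * (a + b))) (2 * t).toNNReal A := by
  set E := {ω | ∃ r ∈ Set.Icc 0 t, ∃ s ∈ Set.Icc 0 t, r ≤ s ∧ a ≤ B r ω ∧ B s ω ≤ -b}
  have hν {S : Set ℝ} (hS : MeasurableSet S) :
      (P.restrict E).map (B t) S = P {ω | ω ∈ E ∧ B t ω ∈ S} := by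
    rw [Measure.map_apply (hB.meas t) hS, Measure.restrict_apply (hB.meas t hS), Set.inter_comm]
    rfl
  change P {ω | ω ∈ E ∧ B t ω ∈ A} ≤ _
  rw [← hν hA, hA.measure_eq_iSup_isCompact]
  refine iSup₂_le fun K hKA ↦ iSup_le fun hK ↦ ?_
  rw [hν hK.measurableSet]
  exact (hB.measure_up_down_isCompact_le ht ha hb hK).trans (measure_mono hKA)

lemma measure_down_up_le (hB : IsBrownianMotion2 P B t) (ht : 0 < t) {a b : ℝ}
    (ha : 0 ≤ a) (hb : 0 ≤ b) {A : Set ℝ} (hA : MeasurableSet A) :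
    P {ω | (∃ s ∈ Set.Icc 0 t, ∃ r ∈ Set.Icc 0 t, s ≤ r ∧ B s ω ≤ -b ∧ a ≤ B r ω) ∧ B t ω ∈ A} ≤
      gaussianReal (2 * (a + b)) (2 * t).toNNReal A := by
  have h := hB.neg.measure_up_down_le ht hb ha (A := (fun x ↦ -x) ⁻¹' A) (measurable_neg hA)
  rw [← Measure.map_apply measurable_neg hA, gaussianReal_map_neg, neg_neg, add_comm b a] at h
  simpa [le_neg] using h

end IsBrownianMotion2

lemma gaussianPDFReal_two_mul {t : ℝ} (ht : 0 < t) (m x : ℝ) :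
    gaussianPDFReal m (2 * t).toNNReal x =
      (4 * Real.pi * t) ^ (-(1 : ℝ) / 2) * Real.exp (-(x - m) ^ 2 / (4 * t)) := by
  have h : 0 < 4 * Real.pi * t := by positivity
  rw [gaussianPDFReal, Real.coe_toNNReal _ (by positivity), neg_div 2 (1 : ℝ), Real.rpow_neg h.le,
    ← Real.sqrt_eq_rpow]
  congr 3 <;> ring_nf

/-- **Double reflection bound** (from Lemma 7.1 of the paper). If `B` is a Brownian motion
of variance `2` on `[0, t]`, `a, b ≥ 0`, and `A ⊆ [−b, a]` is Borel, then
`P(sup B ≥ a, inf B ≤ −b, B(t) ∈ A)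
   ≤ ∫_A (4πt)^{−1/2} [exp(−(2a+2b−x)²/(4t)) + exp(−(2a+2b+x)²/(4t))] dx`. -/
theorem double_reflection_bound
    {Ω : Type*} [MeasurableSpace Ω] (P : Measure Ω) [IsProbabilityMeasure P]
    (t : ℝ) (ht : 0 < t) (B : ℝ → Ω → ℝ) (hB : IsBrownianMotion2 P B t)
    (a b : ℝ) (ha : 0 ≤ a) (hb : 0 ≤ b)
    (A : Set ℝ) (hA : MeasurableSet A) (hAsub : A ⊆ Set.Icc (-b) a) :
    P {ω | a ≤ (⨆ s : Set.Icc (0 : ℝ) t, B (s : ℝ) ω) ∧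
        (⨅ s : Set.Icc (0 : ℝ) t, B (s : ℝ) ω) ≤ -b ∧ B t ω ∈ A} ≤
      ENNReal.ofReal (∫ x in A, (4 * Real.pi * t) ^ (-(1 : ℝ) / 2) *
        (Real.exp (-(2 * a + 2 * b - x) ^ 2 / (4 * t)) +
          Real.exp (-(2 * a + 2 * b + x) ^ 2 / (4 * t)))) := by
  have hv : (2 * t).toNNReal ≠ 0 := (Real.toNNReal_pos.2 (by positivity)).ne'
  have hsum : ENNReal.ofReal (∫ x in A, (4 * Real.pi * t) ^ (-(1 : ℝ) / 2) *
      (Real.exp (-(2 * a + 2 * b - x) ^ 2 / (4 * t)) +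
        Real.exp (-(2 * a + 2 * b + x) ^ 2 / (4 * t)))) =
      gaussianReal (-(2 * (a + b))) (2 * t).toNNReal A +
        gaussianReal (2 * (a + b)) (2 * t).toNNReal A := by
    rw [gaussianReal_apply_eq_integral _ hv, gaussianReal_apply_eq_integral _ hv,
      ← ENNReal.ofReal_add (integral_nonneg fun _ ↦ gaussianPDFReal_nonneg _ _ _)
        (integral_nonneg fun _ ↦ gaussianPDFReal_nonneg _ _ _),
      ← integral_add (integrable_gaussianPDFReal _ _).restrict
        (integrable_gaussianPDFReal _ _).restrict]
    congr 2 with x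
    rw [gaussianPDFReal_two_mul ht, gaussianPDFReal_two_mul ht]
    ring_nf
  rw [hsum]
  refine le_trans (measure_mono_ae ?_) ((measure_union_le _ _).trans
    (add_le_add (hB.measure_up_down_le ht ha hb hA) (hB.measure_down_up_le ht ha hb hA)))
  filter_upwards [hB.cont] with ω hcont
  rintro ⟨hsup, hinf, hA'⟩
  have hne : (Set.Icc 0 t).Nonempty := Set.nonempty_Icc.2 ht.le
  obtain ⟨r, hr, hr', -⟩ := isCompact_Icc.exists_sSup_image_eq_and_ge hne hcont
  obtain ⟨s, hs, hs', -⟩ := isCompact_Icc.exists_sInf_image_eq_and_le hne hcont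
  rw [sSup_image'] at hr'
  rw [sInf_image'] at hs'
  rw [hr'] at hsup
  rw [hs'] at hinf
  rcases le_total r s with h | h
  · exact .inl ⟨⟨r, hr, s, hs, h, hsup, hinf⟩, hA'⟩
  · exact .inr ⟨⟨s, hs, r, hr, h, hinf, hsup⟩, hA'⟩
end
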